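/- The determinant of M equals -8, and the cokernel ℤ¹⁴ / M·ℤ¹⁴ of the linear map ℤ¹⁴ → ℤ¹⁴ given by M is isomorphic as an abelian group to (ℤ/4ℤ) × (ℤ/2ℤ). In particular the discriminant group of the lattice (ℤ¹⁴, M) has minimal number of generators 2. -/

import Mathlib

open Matrix

def M : Matrix (Fin 14) (Fin 14) ℤ :=
  !![-2, 0, 0, 0, 0, 0, 1, 0, 0, 0, 0, 0, 0, 0;
    0, -2, 0, 0, 0, 0, 1, 1, 0, 1, 0, 0, 0, 0;
    0, 0, -2, 1, 0, 0, 0, 0, 1, 0, 0, 0, 0, 1;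
    0, 0, 1, -2, 1, 1, 0, 0, 0, 0, 0, 0, 0, 0;
    0, 0, 0, 1, -2, 0, 0, 0, 0, 0, 0, 0, 0, 0;
    0, 0, 0, 1, 0, -2, 0, 0, 0, 0, 0, 0, 0, 0;
    1, 1, 0, 0, 0, 0, -2, 0, 0, 0, 0, 0, 0, 0;
    0, 1, 0, 0, 0, 0, 0, -2, 0, 0, 0, 0, 0, 0;
    0, 0, 1, 0, 0, 0, 0, 0, -2, 0, 0, 0, 0, 0;
    0, 1, 0, 0, 0, 0, 0, 0, 0, -2, 1, 0, 0, 0;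
    0, 0, 0, 0, 0, 0, 0, 0, 0, 1, -2, 1, 0, 0;
    0, 0, 0, 0, 0, 0, 0, 0, 0, 0, 1, -2, 1, 0;
    0, 0, 0, 0, 0, 0, 0, 0, 0, 0, 0, 1, -2, 1;
    0, 0, 1, 0, 0, 0, 0, 0, 0, 0, 0, 0, 1, -2]

/-- A lower triangular matrix whose product with `M` is upper triangular. -/
def triL : Matrix (Fin 14) (Fin 14) ℤ :=
  !![1, 0, 0, 0, 0, 0, 0, 0, 0, 0, 0, 0, 0, 0;
    0, 1, 0, 0, 0, 0, 0, 0, 0, 0, 0, 0, 0, 0;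
    0, 0, 1, 0, 0, 0, 0, 0, 0, 0, 0, 0, 0, 0;
    0, 0, 1, 2, 0, 0, 0, 0, 0, 0, 0, 0, 0, 0;
    0, 0, 1, 2, 3, 0, 0, 0, 0, 0, 0, 0, 0, 0;
    0, 0, 1, 2, 1, 2, 0, 0, 0, 0, 0, 0, 0, 0;
    1, 1, 0, 0, 0, 0, 2, 0, 0, 0, 0, 0, 0, 0;
    1, 3, 0, 0, 0, 0, 2, 4, 0, 0, 0, 0, 0, 0;
    0, 0, 2, 2, 1, 1, 0, 0, 2, 0, 0, 0, 0, 0;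
    2, 6, 0, 0, 0, 0, 4, 3, 0, 5, 0, 0, 0, 0;
    2, 6, 0, 0, 0, 0, 4, 3, 0, 5, 4, 0, 0, 0;
    2, 6, 0, 0, 0, 0, 4, 3, 0, 5, 4, 3, 0, 0;
    2, 6, 0, 0, 0, 0, 4, 3, 0, 5, 4, 3, 2, 0;
    2, 6, 2, 2, 1, 1, 4, 3, 1, 5, 4, 3, 2, 1]

/-- The upper triangular matrix `triL * M`. -/
def triT : Matrix (Fin 14) (Fin 14) ℤ :=
  !![-2, 0, 0, 0, 0, 0, 1, 0, 0, 0, 0, 0, 0, 0;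
    0, -2, 0, 0, 0, 0, 1, 1, 0, 1, 0, 0, 0, 0;
    0, 0, -2, 1, 0, 0, 0, 0, 1, 0, 0, 0, 0, 1;
    0, 0, 0, -3, 2, 2, 0, 0, 1, 0, 0, 0, 0, 1;
    0, 0, 0, 0, -4, 2, 0, 0, 1, 0, 0, 0, 0, 1;
    0, 0, 0, 0, 0, -2, 0, 0, 1, 0, 0, 0, 0, 1;
    0, 0, 0, 0, 0, 0, -2, 1, 0, 1, 0, 0, 0, 0;
    0, 0, 0, 0, 0, 0, 0, -5, 0, 3, 0, 0, 0, 0;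
    0, 0, 0, 0, 0, 0, 0, 0, -2, 0, 0, 0, 0, 2;
    0, 0, 0, 0, 0, 0, 0, 0, 0, -4, 5, 0, 0, 0;
    0, 0, 0, 0, 0, 0, 0, 0, 0, 0, -3, 4, 0, 0;
    0, 0, 0, 0, 0, 0, 0, 0, 0, 0, 0, -2, 3, 0;
    0, 0, 0, 0, 0, 0, 0, 0, 0, 0, 0, 0, -1, 2;
    0, 0, 0, 0, 0, 0, 0, 0, 0, 0, 0, 0, 0, 2]

/-- The row transformation bringing `M` to Smith normal form. -/
def smithU : Matrix (Fin 14) (Fin 14) ℤ :=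
  !![1, 0, 0, 0, 0, 0, 0, 0, 0, 0, 0, 0, 0, 0;
    -1, 1, 0, 0, 0, 0, 0, 0, 0, 0, 0, 0, 0, 0;
    0, 0, 1, 0, 0, 0, 0, 0, 0, 0, 0, 0, 0, 0;
    0, 0, 2, 1, 0, 0, 0, 0, 0, 0, 0, 0, 0, 0;
    0, 0, -1, 0, 0, 1, 0, 0, 0, 0, 0, 0, 0, 0;
    2, 0, 0, 0, 0, 0, 1, 0, 0, 0, 0, 0, 0, 0;
    -2, 0, 0, 0, 0, 0, -1, 0, 0, 1, 0, 0, 0, 0;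
    -4, 0, 0, 0, 0, 0, -2, 0, 0, 2, 1, 0, 0, 0;
    -6, 0, 0, 0, 0, 0, -3, 0, 0, 3, 2, 1, 0, 0;
    -8, 0, 0, 0, 0, 0, -4, 0, 0, 4, 3, 2, 1, 0;
    -10, 0, 0, 0, 0, 0, -5, 0, 0, 5, 4, 3, 2, 1;
    4, 2, 0, 0, 0, 0, 3, 1, 0, 0, 0, 0, 0, 0;
    -2, 6, 2, 0, 0, -2, 2, 3, 1, 7, 6, 5, 4, 3;
    -4, -12, 0, 2, 1, 3, -8, -6, 0, -10, -8, -6, -4, -2]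

/-- The inverse of `smithU`. -/
def smithUInv : Matrix (Fin 14) (Fin 14) ℤ :=
  !![1, 0, 0, 0, 0, 0, 0, 0, 0, 0, 0, 0, 0, 0;
    1, 1, 0, 0, 0, 0, 0, 0, 0, 0, 0, 0, 0, 0;
    0, 0, 1, 0, 0, 0, 0, 0, 0, 0, 0, 0, 0, 0;
    0, 0, -2, 1, 0, 0, 0, 0, 0, 0, 0, 0, 0, 0;
    0, 0, 1, -2, -3, 0, 0, 0, 0, 0, 2, 6, 0, 1;
    0, 0, 1, 0, 1, 0, 0, 0, 0, 0, 0, 0, 0, 0;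
    -2, 0, 0, 0, 0, 1, 0, 0, 0, 0, 0, 0, 0, 0;
    0, -2, 0, 0, 0, -3, 0, 0, 0, 0, 0, 1, 0, 0;
    0, 0, 0, 0, 2, 0, 0, 0, 0, 2, -3, -3, 1, 0;
    0, 0, 0, 0, 0, 1, 1, 0, 0, 0, 0, 0, 0, 0;
    0, 0, 0, 0, 0, 0, -2, 1, 0, 0, 0, 0, 0, 0;
    0, 0, 0, 0, 0, 0, 1, -2, 1, 0, 0, 0, 0, 0;
    0, 0, 0, 0, 0, 0, 0, 1, -2, 1, 0, 0, 0, 0;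
    0, 0, 0, 0, 0, 0, 0, 0, 1, -2, 1, 0, 0, 0]

/-- The column transformation bringing `M` to Smith normal form. -/
def smithV : Matrix (Fin 14) (Fin 14) ℤ :=
  !![0, 0, 0, 0, 0, 0, 0, 0, 0, 0, 0, 1, 2, 4;
    0, 0, 0, 0, 0, 1, 0, 0, 0, 0, 0, 3, 6, 12;
    0, 0, 0, 0, 0, 0, 0, 0, 0, 0, 1, 3, 0, 0;
    0, 0, 1, 0, 1, 0, 0, 0, 0, 0, 0, 0, 0, -2;
    0, 0, 0, 1, 2, 0, 0, 0, 0, 0, -1, -3, 0, -3;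
    0, 0, 0, 0, 0, 0, 0, 0, 0, 0, 0, 0, 0, -1;
    1, 0, 0, 0, 0, 0, 0, 0, 0, 0, 0, 2, 4, 8;
    0, 1, 0, 0, 0, 2, 0, 0, 0, 0, 0, 1, 3, 6;
    0, 0, 0, 0, -1, 0, 0, 0, 0, -1, 2, 3, -1, 0;
    0, 0, 0, 0, 0, 0, 0, 0, 0, 0, 0, 3, 5, 10;
    0, 0, 0, 0, 0, 0, 1, 0, 0, 0, 0, 3, 4, 8;
    0, 0, 0, 0, 0, 0, 0, 1, 0, 0, 0, 3, 3, 6;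
    0, 0, 0, 0, 0, 0, 0, 0, 1, 0, 0, 3, 2, 4;
    0, 0, 0, 0, 0, 0, 0, 0, 0, 1, 0, 3, 1, 2]

/-- The inverse of `smithV`. -/
def smithVInv : Matrix (Fin 14) (Fin 14) ℤ :=
  !![-2, 0, 0, 0, 0, 0, 1, 0, 0, 0, 0, 0, 0, 0;
    2, -2, 0, 0, 0, 0, 0, 1, 0, 1, 0, 0, 0, 0;
    0, 0, -2, 1, 0, 0, 0, 0, 1, 0, 0, 0, 0, 1;
    0, 0, -3, 0, 1, 1, 0, 0, 2, 0, 0, 0, 0, 2;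
    0, 0, 2, 0, 0, -2, 0, 0, -1, 0, 0, 0, 0, -1;
    -3, 1, 0, 0, 0, 0, 0, 0, 0, 0, 0, 0, 0, 0;
    3, 0, 0, 0, 0, 0, 0, 0, 0, -2, 1, 0, 0, 0;
    6, 0, 0, 0, 0, 0, 0, 0, 0, -3, 0, 1, 0, 0;
    9, 0, 0, 0, 0, 0, 0, 0, 0, -4, 0, 0, 1, 0;
    12, 0, 0, 0, 0, 0, 0, 0, 0, -5, 0, 0, 0, 1;
    15, 0, 1, 0, 0, 0, 0, 0, 0, -6, 0, 0, 0, 0;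
    -5, 0, 0, 0, 0, 0, 0, 0, 0, 2, 0, 0, 0, 0;
    3, 0, 0, 0, 0, 2, 0, 0, 0, -1, 0, 0, 0, 0;
    0, 0, 0, 0, 0, -1, 0, 0, 0, 0, 0, 0, 0, 0]

/-- The elementary divisors of `M`. -/
def elemDiv : Fin 14 → ℤ := ![1, 1, 1, 1, 1, 1, 1, 1, 1, 1, 1, 1, 2, 4]

lemma triL_mul_M : triL * M = triT := by decide +kernel

lemma smithU_mul_smithUInv : smithU * smithUInv = 1 := by decide +kernel

lemma smithUInv_mul_smithU : smithUInv * smithU = 1 :=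
  mul_eq_one_comm.mp smithU_mul_smithUInv

lemma M_mul_smithV : M * smithV = smithUInv * diagonal elemDiv := by decide +kernel

lemma smithU_mul_M : smithU * M = diagonal elemDiv * smithVInv := by decide +kernel

lemma det_M : M.det = -8 := by
  have hL : triL.det = ∏ i, triL i i := det_of_isLowerTriangular _ (by
    have h : ∀ i j : Fin 14, i < j → (triL i j).natAbs = 0 := by decide +kernel
    exact fun i j hij => Int.natAbs_eq_zero.mp (h i j hij))
  have hT : triT.det = ∏ i, triT i i := det_of_isUpperTriangular (by
    have h : ∀ i j : Fin 14, j < i → (triT i j).natAbs = 0 := by decide +kernel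
    exact fun i j hij => Int.natAbs_eq_zero.mp (h i j hij))
  have hne : ∏ i, triL i i ≠ 0 := by decide +kernel
  have hprod : ∏ i, triT i i = (∏ i, triL i i) * (-8) := by decide +kernel
  have h := congrArg det triL_mul_M
  rw [det_mul, hL, hT, hprod] at h
  exact mul_left_cancel₀ hne h

/-- The map reading off the residues of the last two coordinates after applying `smithU`. -/
def residueMap : (Fin 14 → ℤ) →ₗ[ℤ] ZMod 4 × ZMod 2 :=
  (((Int.castAddHom (ZMod 4)).toIntLinearMap ∘ₗ LinearMap.proj 13).prod
    ((Int.castAddHom (ZMod 2)).toIntLinearMap ∘ₗ LinearMap.proj 12)) ∘ₗ smithU.mulVecLin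

lemma residueMap_apply (x : Fin 14 → ℤ) :
    residueMap x = (((smithU *ᵥ x) 13 : ZMod 4), ((smithU *ᵥ x) 12 : ZMod 2)) := rfl

lemma residueMap_surjective : Function.Surjective residueMap := by
  rintro ⟨a, b⟩
  obtain ⟨a, rfl⟩ := ZMod.intCast_surjective a
  obtain ⟨b, rfl⟩ := ZMod.intCast_surjective b
  refine ⟨smithUInv *ᵥ (Pi.single 13 a + Pi.single 12 b), ?_⟩
  rw [residueMap_apply, mulVec_mulVec, smithU_mul_smithUInv, one_mulVec]
  simp

lemma range_toLin'_M : LinearMap.range (toLin' M) = LinearMap.ker residueMap := by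
  ext x
  rw [LinearMap.mem_ker, residueMap_apply, Prod.mk_eq_zero,
    ZMod.intCast_zmod_eq_zero_iff_dvd, ZMod.intCast_zmod_eq_zero_iff_dvd]
  constructor
  · rintro ⟨z, rfl⟩
    rw [toLin'_apply, mulVec_mulVec, smithU_mul_M, ← mulVec_mulVec,
      mulVec_diagonal, mulVec_diagonal]
    exact ⟨Dvd.intro _ rfl, Dvd.intro _ rfl⟩
  · rintro ⟨h4, h2⟩
    have hdvd : ∀ i, elemDiv i ∣ (smithU *ᵥ x) i := by
      intro i
      fin_cases i
      all_goals first | exact one_dvd _ | exact h2 | exact h4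
    choose y hy using hdvd
    refine ⟨smithV *ᵥ y, ?_⟩
    have hD : diagonal elemDiv *ᵥ y = smithU *ᵥ x := by
      ext i
      rw [mulVec_diagonal, hy]
    rw [toLin'_apply, mulVec_mulVec, M_mul_smithV, ← mulVec_mulVec, hD, mulVec_mulVec,
      smithUInv_mul_smithU, one_mulVec]

theorem stmt_1 :
    M.det = -8 ∧
    Nonempty (((Fin 14 → ℤ) ⧸ LinearMap.range (Matrix.toLin' M)) ≃+ (ZMod 4 × ZMod 2)) := by
  exact ⟨det_M, ⟨((Submodule.quotEquivOfEq _ _ range_toLin'_M).trans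
    (residueMap.quotKerEquivOfSurjective residueMap_surjective)).toAddEquiv⟩⟩
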